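/- There is an absolute constant C > 0 such that for every σ > 0 and all ξ, ξ₁ ∈ ℝ: e^{σ|ξ−ξ₁|} e^{σ|ξ₁|} − e^{σ|ξ|} ≤ C σ (⟨ξ−ξ₁⟩ ⟨ξ₁⟩ / ⟨ξ⟩) e^{σ|ξ−ξ₁|} e^{σ|ξ₁|}. -/

import Mathlib

/-- The Japanese bracket `⟨x⟩ = (1 + x²)^{1/2}`. -/
noncomputable def jb (x : ℝ) : ℝ := Real.sqrt (1 + x ^ 2)

theorem jb_pos (x : ℝ) : 0 < jb x := Real.sqrt_pos.2 (by positivity)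

theorem sq_jb (x : ℝ) : jb x ^ 2 = 1 + x ^ 2 := Real.sq_sqrt (by positivity)

theorem abs_le_jb (x : ℝ) : |x| ≤ jb x := Real.abs_le_sqrt (by linarith)

theorem jb_add_le (x y : ℝ) : jb (x + y) ≤ jb x + jb y := by
  have hxy : x * y ≤ jb x * jb y := calc
    x * y ≤ |x * y| := le_abs_self _
    _ = |x| * |y| := abs_mul x y
    _ ≤ jb x * jb y :=
      mul_le_mul (abs_le_jb x) (abs_le_jb y) (abs_nonneg y) (jb_pos x).le
  refine le_of_sq_le_sq ?_ (add_pos (jb_pos x) (jb_pos y)).le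
  nlinarith [sq_jb x, sq_jb y, sq_jb (x + y)]

/-- The defect in the triangle inequality is controlled by Japanese brackets. -/
theorem abs_add_abs_sub_abs_add_le (x y : ℝ) :
    |x| + |y| - |x + y| ≤ 4 * (jb x * jb y / jb (x + y)) := by
  have hx : |x| + |y| - |x + y| ≤ 2 * jb x := by
    have h := abs_sub (x + y) x
    rw [add_sub_cancel_left] at h
    linarith [abs_le_jb x]
  have hy : |x| + |y| - |x + y| ≤ 2 * jb y := by
    have h := abs_sub (x + y) y
    rw [add_sub_cancel_right] at h
    linarith [abs_le_jb y]
  have h0 : 0 ≤ |x| + |y| - |x + y| := sub_nonneg.2 (abs_add_le x y)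
  rw [← mul_div_assoc, le_div_iff₀ (jb_pos _)]
  calc
    (|x| + |y| - |x + y|) * jb (x + y) ≤ (|x| + |y| - |x + y|) * (jb x + jb y) :=
      mul_le_mul_of_nonneg_left (jb_add_le x y) h0
    _ ≤ 4 * (jb x * jb y) := by
      linarith [mul_le_mul_of_nonneg_right hx (jb_pos y).le,
        mul_le_mul_of_nonneg_right hy (jb_pos x).le]

theorem exp_sub_exp_le (a b : ℝ) : Real.exp a - Real.exp b ≤ (a - b) * Real.exp a := by
  have h := mul_le_mul_of_nonneg_right (Real.add_one_le_exp (b - a)) (Real.exp_pos a).le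
  rw [← Real.exp_add, sub_add_cancel] at h
  linarith

/-- There is an absolute constant `C > 0` such that for every `σ > 0` and all `ξ, ξ₁ ∈ ℝ`,
`e^{σ|ξ−ξ₁|} e^{σ|ξ₁|} − e^{σ|ξ|} ≤ C σ (⟨ξ−ξ₁⟩ ⟨ξ₁⟩ / ⟨ξ⟩) e^{σ|ξ−ξ₁|} e^{σ|ξ₁|}`. -/
theorem exp_weight_commutator_bound :
    ∃ C > (0 : ℝ), ∀ σ > (0 : ℝ), ∀ ξ ξ₁ : ℝ,
      Real.exp (σ * |ξ - ξ₁|) * Real.exp (σ * |ξ₁|) - Real.exp (σ * |ξ|) ≤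
        C * σ * (jb (ξ - ξ₁) * jb ξ₁ / jb ξ) *
          (Real.exp (σ * |ξ - ξ₁|) * Real.exp (σ * |ξ₁|)) := by
  refine ⟨4, by norm_num, fun σ hσ ξ ξ₁ => ?_⟩
  have h := abs_add_abs_sub_abs_add_le (ξ - ξ₁) ξ₁
  rw [sub_add_cancel] at h
  rw [← Real.exp_add]
  refine (exp_sub_exp_le _ _).trans (mul_le_mul_of_nonneg_right ?_ (Real.exp_pos _).le)
  linarith [mul_le_mul_of_nonneg_left h hσ.le]
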